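/- Let b > 0 be a real number and n ≥ 1 an integer. Then det(V_n(b)) < (√b + 1)^{2n}. -/

import Mathlib

open Real Matrix Finset

noncomputable def V (b : ℝ) (n : ℕ) : Matrix (Fin n) (Fin n) ℝ :=
  Matrix.of fun i j =>
    if (i : ℕ) = (j : ℕ) then b + 1
    else if (j : ℕ) = (i : ℕ) + 1 then 1
    else if (i : ℕ) = (j : ℕ) + 1 then b
    else 0

theorem det_V_add_two (b : ℝ) (n : ℕ) :
    (V b (n + 2)).det = (b + 1) * (V b (n + 1)).det - b * (V b n).det := by
  have hsub : (V b (n + 2)).submatrix Fin.succ (Fin.succAbove 0) = V b (n + 1) := by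
    ext i j
    simp [V]
  have hminor : ((V b (n + 2)).submatrix Fin.succ (Fin.succAbove 1)).det = b * (V b n).det := by
    have hsub' : ((V b (n + 2)).submatrix Fin.succ (Fin.succAbove 1)).submatrix
        (Fin.succAbove 0) Fin.succ = V b n := by
      ext i j
      have h : (Fin.succAbove (1 : Fin (n + 2)) j.succ : Fin (n + 2)) = j.succ.succ := by
        rw [← Fin.succ_zero_eq_one, Fin.succ_succAbove_succ, Fin.zero_succAbove]
      simp [V, h]
    rw [det_succ_column_zero, Fin.sum_univ_succ, hsub']
    simp [V]
  rw [det_succ_row_zero, Fin.sum_univ_succ, Fin.sum_univ_succ, hsub, Fin.succ_zero_eq_one,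
    hminor]
  simp [V]
  ring

theorem det_V_succ (b : ℝ) (n : ℕ) : (V b (n + 1)).det = b * (V b n).det + 1 := by
  induction n with
  | zero => simp [V]
  | succ n ih => rw [det_V_add_two]; linarith

theorem one_le_det_V {b : ℝ} (hb : 0 ≤ b) (n : ℕ) : 1 ≤ (V b n).det := by
  induction n with
  | zero => simp
  | succ n ih => rw [det_V_succ]; nlinarith

theorem det_V_succ_lt {b : ℝ} (hb : 0 < b) (n : ℕ) :
    (V b (n + 1)).det < (√b + 1) ^ 2 * (V b n).det := by
  have h1 := one_le_det_V hb.le n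
  have hs := Real.sqrt_pos.2 hb
  have hsq := Real.sq_sqrt hb.le
  rw [det_V_succ]
  nlinarith [mul_pos hs (zero_lt_one.trans_le h1)]

theorem stmt12 (b : ℝ) (hb : 0 < b) (n : ℕ) (hn : 1 ≤ n) :
    (V b n).det < (Real.sqrt b + 1) ^ (2 * n) := by
  induction n, hn using Nat.le_induction with
  | base => simpa using det_V_succ_lt hb 0
  | succ n hn ih =>
    calc (V b (n + 1)).det < (√b + 1) ^ 2 * (V b n).det := det_V_succ_lt hb n
      _ ≤ (√b + 1) ^ 2 * (√b + 1) ^ (2 * n) := by gcongr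
      _ = (√b + 1) ^ (2 * (n + 1)) := by ring
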